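/- arXiv:2210.02233 — 2 statements merged into one kernel-verified Lean document; each statement's English description precedes it below -/
import Mathlib

section
/- Let q and a be positive integers with gcd(a,q) = 1, and let ν be a Borel probability measure on the torus 𝕋 supported on the finite set 𝕋_q = {j/q : 0 ≤ j ≤ q−1}. Then there is a good set S ⊆ ℕ with μ_{S,a/q} = ν. -/
open MeasureTheory Filter Topology
open scoped BigOperators

noncomputable section

open Classical in
/-- `S(N) = S ∩ {1,…,N}` as a `Finset`. -/
def initSeg (S : Set ℕ) (N : ℕ) : Finset ℕ := (Finset.Icc 1 N).filter (· ∈ S)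

/-- The average `(1/#S(N)) ∑_{s ∈ S(N)} f (sα mod 1)`. -/
def empAvg (S : Set ℕ) (α : ℝ) (N : ℕ) (f : UnitAddCircle → ℝ) : ℝ :=
  ((initSeg S N).card : ℝ)⁻¹ * ∑ s ∈ initSeg S N, f (((s : ℝ) * α : ℝ) : UnitAddCircle)

/-- `μ` is the weak limit of the empirical measures `(1/#S(N)) ∑_{s ∈ S(N)} δ_{sα mod 1}`. -/
def IsLimitMeasure (S : Set ℕ) (α : ℝ) (μ : Measure UnitAddCircle) : Prop :=
  ∀ f : C(UnitAddCircle, ℝ),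
    Tendsto (fun N => empAvg S α N (fun x => f x)) atTop (𝓝 (∫ x, f x ∂μ))

/-- A good set: infinite, and for every `α` the empirical measures converge weakly
to some (probability) limit measure `μ_{S,α}`. -/
def IsGoodSet (S : Set ℕ) : Prop :=
  S.Infinite ∧ ∀ α : ℝ, ∃ μ : Measure UnitAddCircle, IsProbabilityMeasure μ ∧ IsLimitMeasure S α μ

/-- `R` is sublacunary: `log N / #R(N) → 0`. -/
def Sublacunary (R : Set ℕ) : Prop :=
  Tendsto (fun N : ℕ => Real.log N / ((initSeg R N).card : ℝ)) atTop (𝓝 0)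

open Classical in
/-- `#{n < N : r_n ∈ S}` where `(r_n)` is the increasing (0-indexed) enumeration of `R`. -/
def relCount (R S : Set ℕ) (N : ℕ) : ℕ :=
  ((Finset.range N).filter (fun n => Nat.nth (· ∈ R) n ∈ S)).card

/-- Weighted average `(1/∑_{n<N} w n) ∑_{n<N} w n · f (r_n β mod 1)`. -/
def wAvg (R : Set ℕ) (w : ℕ → ℝ) (β : ℝ) (N : ℕ) (f : UnitAddCircle → ℝ) : ℝ :=
  (∑ n ∈ Finset.range N, w n)⁻¹ *
    ∑ n ∈ Finset.range N, w n * f (((Nat.nth (· ∈ R) n : ℝ) * β : ℝ) : UnitAddCircle)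

/-- `μ` is the weak limit of the `w`-weighted empirical measures along `R` at `β`. -/
def IsWeightLimit (R : Set ℕ) (w : ℕ → ℝ) (β : ℝ) (μ : Measure UnitAddCircle) : Prop :=
  ∀ f : C(UnitAddCircle, ℝ),
    Tendsto (fun N => wAvg R w β N (fun x => f x)) atTop (𝓝 (∫ x, f x ∂μ))

/-- A good weight on `R` (indexed by the increasing enumeration of `R`). -/
def IsGoodWeight (R : Set ℕ) (w : ℕ → ℝ) : Prop :=
  (∀ n, 0 ≤ w n) ∧ ¬ Summable w ∧
    ∀ β : ℝ, ∃ μ : Measure UnitAddCircle, IsProbabilityMeasure μ ∧ IsWeightLimit R w β μ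

/-- Besicovitch-type seminorm `‖f‖₁ = limsup_N (1/N) ∑_{n<N} |f n|`. -/
def besic (f : ℕ → ℝ) : ℝ := Filter.limsup (fun N => (∑ n ∈ Finset.range N, |f n|) / N) atTop

/-- An integrable weight: approximable in `‖·‖₁` by bounded good weights. -/
def IntegrableWeight (R : Set ℕ) (w : ℕ → ℝ) : Prop :=
  ∀ ε > 0, ∃ v : ℕ → ℝ, IsGoodWeight R v ∧ (∃ C, ∀ n, v n ≤ C) ∧
    besic (fun n => v n - w n) < ε

/-- Total variation distance between two finite Borel measures on the torus. -/
def varDist (μ ν : Measure UnitAddCircle) : ℝ :=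
  ⨆ B : Set UnitAddCircle, ⨆ _ : MeasurableSet B, |(μ B).toReal - (ν B).toReal|

/-- `e(θ) = exp(2πiθ)`. -/
def eC (θ : ℝ) : ℂ := Complex.exp (2 * Real.pi * Complex.I * θ)

/-- `w(R(N)) = ∑_{r ∈ R(N)} w r`. -/
def wSum (R : Set ℕ) (w : ℕ → ℝ) (N : ℕ) : ℝ := ∑ r ∈ initSeg R N, w r

/-- `μ` is the weak limit of `(1/w(R(N))) ∑_{r ∈ R(N)} w r · δ_{rβ mod 1}`. -/
def IsWeightLimitR (R : Set ℕ) (w : ℕ → ℝ) (β : ℝ) (μ : Measure UnitAddCircle) : Prop :=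
  ∀ f : C(UnitAddCircle, ℝ),
    Tendsto
      (fun N => (wSum R w N)⁻¹ * ∑ r ∈ initSeg R N, w r * f (((r : ℝ) * β : ℝ) : UnitAddCircle))
      atTop (𝓝 (∫ x, f x ∂μ))

/-- `f : ℕ → ℂ` has mean `c`. -/
def HasMean (f : ℕ → ℂ) (c : ℂ) : Prop :=
  Tendsto (fun N => (∑ n ∈ Finset.range N, f n) / (N : ℂ)) atTop (𝓝 c)

/-- The seminorm `‖f‖_M = limsup_N |(1/N) ∑_{n<N} f n|`. -/
def meanSeminorm (f : ℕ → ℂ) : ℝ :=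
  Filter.limsup (fun N => ‖(∑ n ∈ Finset.range N, f n) / (N : ℂ)‖) atTop

end

/-- The sequence `h` has uniform mean `L`: averages over long windows are close to `L`, uniformly in
the position of the window. -/
def HasUniformMean {E : Type*} [NormedAddCommGroup E] [NormedSpace ℝ E] (h : ℕ → E) (L : E) : Prop :=
  ∀ ε > 0, ∃ C : ℝ, ∀ s n : ℕ, ‖∑ i ∈ Finset.range n, h (s + i) - (n : ℝ) • L‖ ≤ ε * n + C

namespace HasUniformMean

variable {E : Type*} [NormedAddCommGroup E] [NormedSpace ℝ E]

theorem const (c : E) : HasUniformMean (fun _ => c) c := by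
  intro ε hε
  refine ⟨0, fun s n => ?_⟩
  have : (∑ i ∈ Finset.range n, c) - (n : ℝ) • c = 0 := by
    simp [Nat.cast_smul_eq_nsmul]
  rw [this]
  simp only [norm_zero]
  positivity

theorem add {h k : ℕ → E} {L M : E} (hh : HasUniformMean h L) (hk : HasUniformMean k M) :
    HasUniformMean (fun n => h n + k n) (L + M) := by
  intro ε hε
  obtain ⟨C, hC⟩ := hh (ε / 2) (by positivity)
  obtain ⟨D, hD⟩ := hk (ε / 2) (by positivity)
  refine ⟨C + D, fun s n => ?_⟩
  have e : ∑ i ∈ Finset.range n, (h (s + i) + k (s + i)) - (n : ℝ) • (L + M)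
      = (∑ i ∈ Finset.range n, h (s + i) - (n : ℝ) • L)
        + (∑ i ∈ Finset.range n, k (s + i) - (n : ℝ) • M) := by
    rw [Finset.sum_add_distrib, smul_add]; abel
  rw [e]
  linarith [norm_add_le (∑ i ∈ Finset.range n, h (s + i) - (n : ℝ) • L)
    (∑ i ∈ Finset.range n, k (s + i) - (n : ℝ) • M), hC s n, hD s n]

theorem const_mul {h : ℕ → ℂ} {L : ℂ} (hh : HasUniformMean h L) (c : ℂ) :
    HasUniformMean (fun n => c * h n) (c * L) := by
  intro ε hε
  obtain ⟨C, hC⟩ := hh (ε / (‖c‖ + 1)) (by positivity)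
  refine ⟨‖c‖ * C, fun s n => ?_⟩
  have e : ∑ i ∈ Finset.range n, c * h (s + i) - (n : ℝ) • (c * L)
      = c * (∑ i ∈ Finset.range n, h (s + i) - (n : ℝ) • L) := by
    rw [← Finset.mul_sum, mul_sub, mul_smul_comm]
  rw [e, norm_mul]
  have h1 : ‖c‖ * (ε / (‖c‖ + 1)) ≤ ε := by
    rw [mul_div_assoc', div_le_iff₀ (by positivity)]
    nlinarith [norm_nonneg c]
  calc _ ≤ ‖c‖ * (ε / (‖c‖ + 1) * n + C) := by gcongr; exact hC s n
    _ = (‖c‖ * (ε / (‖c‖ + 1))) * n + ‖c‖ * C := by ring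
    _ ≤ _ := by gcongr

theorem re {h : ℕ → ℂ} {L : ℂ} (hh : HasUniformMean h L) :
    HasUniformMean (fun n => (h n).re) L.re := by
  intro ε hε
  obtain ⟨C, hC⟩ := hh ε hε
  refine ⟨C, fun s n => le_trans ?_ (hC s n)⟩
  have e : ∑ i ∈ Finset.range n, (h (s + i)).re - (n : ℝ) • L.re
      = (∑ i ∈ Finset.range n, h (s + i) - (n : ℝ) • L).re := by simp
  rw [e]
  exact Complex.abs_re_le_norm _

theorem of_approx {h : ℕ → E} {L : E}
    (H : ∀ ε > 0, ∃ (k : ℕ → E) (M : E), HasUniformMean k M ∧ (∀ n, ‖h n - k n‖ ≤ ε) ∧ ‖L - M‖ ≤ ε) :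
    HasUniformMean h L := by
  intro ε hε
  obtain ⟨k, M, hk, hhk, hLM⟩ := H (ε / 3) (by positivity)
  obtain ⟨C, hC⟩ := hk (ε / 3) (by positivity)
  refine ⟨C, fun s n => ?_⟩
  have e : ∑ i ∈ Finset.range n, h (s + i) - (n : ℝ) • L
      = (∑ i ∈ Finset.range n, (h (s + i) - k (s + i)))
        + (∑ i ∈ Finset.range n, k (s + i) - (n : ℝ) • M) - (n : ℝ) • (L - M) := by
    rw [Finset.sum_sub_distrib, smul_sub]; abel
  have h1 : ‖∑ i ∈ Finset.range n, (h (s + i) - k (s + i))‖ ≤ n * (ε / 3) := by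
    refine (norm_sum_le _ _).trans ((Finset.sum_le_card_nsmul _ _ _ fun i _ => hhk (s + i)).trans ?_)
    simp
  have h2 : ‖(n : ℝ) • (L - M)‖ ≤ n * (ε / 3) := by
    rw [norm_smul]; simp only [Real.norm_natCast]; gcongr
  rw [e]
  refine (norm_sub_le _ _).trans ?_
  linarith [norm_add_le (∑ i ∈ Finset.range n, (h (s + i) - k (s + i)))
    (∑ i ∈ Finset.range n, k (s + i) - (n : ℝ) • M), hC s n]

theorem geometric {z : ℂ} (hz : ‖z‖ = 1) :
    HasUniformMean (fun n => z ^ n) (if z = 1 then 1 else 0) := by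
  split_ifs with h1
  · subst h1
    simpa using const (1 : ℂ)
  · intro ε hε
    refine ⟨2 / ‖z - 1‖, fun s n => ?_⟩
    have e : ∑ i ∈ Finset.range n, z ^ (s + i) - (n : ℝ) • (0 : ℂ)
        = z ^ s * ((z ^ n - 1) / (z - 1)) := by
      simp only [pow_add, ← Finset.mul_sum, geom_sum_eq h1, smul_zero, sub_zero]
    rw [e, norm_mul, norm_pow, hz, one_pow, one_mul, norm_div]
    have h2 : ‖z ^ n - 1‖ ≤ 2 := by
      refine (norm_sub_le _ _).trans ?_
      rw [norm_pow, hz]; norm_num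
    have h3 : ‖z ^ n - 1‖ / ‖z - 1‖ ≤ 2 / ‖z - 1‖ := by gcongr
    have : 0 ≤ ε * n := by positivity
    linarith

theorem bounded {h : ℕ → E} {L : E} (hh : HasUniformMean h L) : ∃ B, 0 ≤ B ∧ ∀ n, ‖h n‖ ≤ B := by
  obtain ⟨C, hC⟩ := hh 1 one_pos
  have key : ∀ n, ‖h n‖ ≤ 1 + C + ‖L‖ := fun n => by
    have h1 := hC n 1
    simp only [Finset.range_one, Finset.sum_singleton, add_zero, Nat.cast_one, one_smul,
      mul_one] at h1
    linarith [norm_le_norm_sub_add (h n) L]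
  exact ⟨_, (norm_nonneg _).trans (key 0), key⟩

end HasUniformMean

/-- The Haar probability measure of the closed subgroup generated by `x` integrates every character
to its mean along the multiples of `x`. -/
theorem exists_measure_integral_fourier (x : UnitAddCircle) :
    ∃ μ : Measure UnitAddCircle, IsProbabilityMeasure μ ∧
      ∀ k : ℤ, ∫ y, fourier k y ∂μ = if (fourier k x : ℂ) = 1 then 1 else 0 := by
  set H := (AddSubgroup.zmultiples x).topologicalClosure with hH
  have hcl : IsClosed (H : Set UnitAddCircle) := AddSubgroup.isClosed_topologicalClosure _
  have : CompactSpace H := isCompact_iff_compactSpace.mp hcl.isCompact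
  have hx : x ∈ H := AddSubgroup.le_topologicalClosure _ (AddSubgroup.mem_zmultiples x)
  let m : Measure H := Measure.addHaarMeasure ⊤
  have : IsProbabilityMeasure m := ⟨by
    have := Measure.addHaarMeasure_self (G := H) (K₀ := ⊤)
    simpa using this⟩
  have hval : Measurable (Subtype.val : H → UnitAddCircle) := measurable_subtype_coe
  refine ⟨m.map Subtype.val, Measure.isProbabilityMeasure_map hval.aemeasurable, fun k => ?_⟩
  have hadd : ∀ y z : UnitAddCircle, (fourier k (y + z) : ℂ) = fourier k y * fourier k z := by
    intro y z
    simp [fourier_apply, AddCircle.toCircle_add]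
  rw [integral_map hval.aemeasurable (fourier k).continuous.aestronglyMeasurable]
  split_ifs with h1
  · have hsub : ∀ y ∈ H, (fourier k y : ℂ) = 1 := by
      intro y hy
      have : closure (AddSubgroup.zmultiples x : Set UnitAddCircle) ⊆ {y | (fourier k y : ℂ) = 1} := by
        refine closure_minimal ?_ (isClosed_eq (fourier k).continuous continuous_const)
        rintro _ ⟨n, rfl⟩
        have h2 : (fourier n ((k • x : UnitAddCircle)) : ℂ) = 1 := by
          have h3 : (AddCircle.toCircle (k • x) : Circle) = 1 :=
            Circle.ext (by simpa [fourier_apply] using h1)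
          simp [fourier_apply, AddCircle.toCircle_zsmul, h3]
        simpa [fourier_apply, smul_smul, mul_comm] using h2
      exact this hy
    have : ∀ y : H, (fourier k (y : UnitAddCircle) : ℂ) = 1 := fun y => hsub y y.2
    simp [this]
  · have h2 := integral_add_left_eq_self (μ := m)
      (fun y : H => (fourier k (y : UnitAddCircle) : ℂ)) ⟨x, hx⟩
    simp only [AddSubgroup.coe_add, hadd, integral_const_mul] at h2
    have h3 : ((fourier k x : ℂ) - 1) * ∫ y : H, (fourier k (y : UnitAddCircle) : ℂ) ∂m = 0 := by
      rw [sub_mul, h2, one_mul, sub_self]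
    exact (mul_eq_zero.mp h3).resolve_left (sub_ne_zero.mpr h1)

/-- Multiples of a point of the circle equidistribute uniformly with respect to some probability
measure. -/
theorem exists_measure_hasUniformMean (x : UnitAddCircle) :
    ∃ μ : Measure UnitAddCircle, IsProbabilityMeasure μ ∧
      ∀ f : C(UnitAddCircle, ℝ), HasUniformMean (fun n : ℕ => f (n • x)) (∫ y, f y ∂μ) := by
  obtain ⟨μ, hμ, hchar⟩ := exists_measure_integral_fourier x
  have hint : ∀ F : C(UnitAddCircle, ℂ), Integrable F μ := fun F =>
    F.continuous.integrable_of_hasCompactSupport (HasCompactSupport.of_compactSpace _)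
  have hspan : ∀ F ∈ Submodule.span ℂ (Set.range (fourier (T := 1))),
      HasUniformMean (fun n : ℕ => F (n • x)) (∫ y, F y ∂μ) := by
    intro F hF
    induction hF using Submodule.span_induction with
    | mem F hF =>
      obtain ⟨k, rfl⟩ := hF
      rw [hchar]
      have h1 : ∀ n : ℕ, (fourier k (n • x) : ℂ) = (fourier k x : ℂ) ^ n := by
        intro n
        have : k • n • x = n • k • x := smul_comm _ _ _
        simp [fourier_apply, this, AddCircle.toCircle_nsmul]
      simp only [h1]
      exact HasUniformMean.geometric (by simp only [fourier_apply, Circle.norm_coe])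
    | zero => simpa using HasUniformMean.const (0 : ℂ)
    | add F G _ _ hF hG =>
      simp only [ContinuousMap.add_apply]
      rw [integral_add (hint F) (hint G)]
      exact hF.add hG
    | smul c F _ hF =>
      simp only [ContinuousMap.smul_apply, smul_eq_mul]
      rw [integral_const_mul]
      exact hF.const_mul c
  have hall : ∀ F : C(UnitAddCircle, ℂ),
      HasUniformMean (fun n : ℕ => F (n • x)) (∫ y, F y ∂μ) := by
    intro F
    refine HasUniformMean.of_approx fun ε hε => ?_
    have hF : F ∈ (Submodule.span ℂ (Set.range (fourier (T := 1)))).topologicalClosure := by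
      rw [span_fourier_closure_eq_top]; trivial
    obtain ⟨G, hG, hFG⟩ := Metric.mem_closure_iff.mp hF ε hε
    have hpt : ∀ y, ‖F y - G y‖ ≤ ε := fun y => by
      rw [← dist_eq_norm]; exact (ContinuousMap.dist_apply_le_dist y).trans hFG.le
    refine ⟨_, _, hspan G hG, fun n => hpt _, ?_⟩
    rw [← integral_sub (hint F) (hint G)]
    simpa using norm_integral_le_of_norm_le_const (μ := μ) (ae_of_all _ hpt)
  refine ⟨μ, hμ, fun f => ?_⟩
  let F : C(UnitAddCircle, ℂ) := ⟨fun y => (f y : ℂ), by fun_prop⟩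
  have h1 := (hall F).re
  have h2 : ∫ y, F y ∂μ = ((∫ y, f y ∂μ : ℝ) : ℂ) := integral_ofReal
  rw [h2] at h1
  exact h1

/-- A union of initial pieces of the blocks `[k², (k+1)²)`, in which the block with index `k`
contributes `⌊w (2k + 1)⌋` elements. It has density `w`. -/
def blockSet (w : ℝ) : Set ℕ :=
  {m | m - Nat.sqrt m * Nat.sqrt m < ⌊w * (2 * (Nat.sqrt m : ℝ) + 1)⌋₊}

theorem abs_sum_range_sub_le {g : ℕ → ℝ} {B : ℝ} (hg : ∀ n, |g n| ≤ B) (n m : ℕ) :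
    |∑ i ∈ Finset.range (n + m), g i - ∑ i ∈ Finset.range n, g i| ≤ B * m := by
  rw [Finset.sum_range_add_sub_sum_range]
  refine (Finset.abs_sum_le_sum_abs _ _).trans
    ((Finset.sum_le_card_nsmul _ _ _ fun i _ => hg (n + i)).trans ?_)
  simp [mul_comm]

theorem tendsto_div_of_abs_sub_le_sqrt {u : ℕ → ℝ} {L : ℝ}
    (H : ∀ ε > 0, ∃ C : ℝ, ∀ M : ℕ, |u M - M * L| ≤ ε * M + C * (Nat.sqrt M + 1)) :
    Tendsto (fun M : ℕ => u M / M) atTop (𝓝 L) := by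
  rw [Metric.tendsto_atTop]
  intro ε hε
  obtain ⟨C, hC⟩ := H (ε / 4) (by positivity)
  obtain ⟨K, hK⟩ := exists_nat_ge (8 * |C| / ε)
  refine ⟨(K + 1) * (K + 1), fun M hM => ?_⟩
  have hKM : K + 1 ≤ Nat.sqrt M := Nat.le_sqrt.mpr hM
  have hsq : Nat.sqrt M * Nat.sqrt M ≤ M := Nat.sqrt_le M
  have hMpos : (0 : ℝ) < M := by
    have : 0 < M := lt_of_lt_of_le (by positivity) hM
    exact_mod_cast this
  have hKM' : (K : ℝ) + 1 ≤ Nat.sqrt M := by exact_mod_cast hKM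
  have hsq' : (Nat.sqrt M : ℝ) * Nat.sqrt M ≤ M := by exact_mod_cast hsq
  have hK0 : (0 : ℝ) ≤ K := by positivity
  have hC := hC M
  generalize (Nat.sqrt M : ℝ) = R at *
  have h1 : 8 * |C| ≤ R * ε := by
    rw [div_le_iff₀ hε] at hK
    nlinarith
  have h2 : C * (R + 1) ≤ ε / 4 * M := by
    have : C * (R + 1) ≤ |C| * (2 * R) := by
      have := le_abs_self C
      have := abs_nonneg C
      nlinarith
    nlinarith
  have hCM : |u M - M * L| ≤ ε / 4 * M + ε / 4 * M := hC.trans (by gcongr)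
  rw [Real.dist_eq]
  have e : u M / M - L = (u M - M * L) / M := by field_simp
  rw [e, abs_div, abs_of_pos hMpos, div_lt_iff₀ hMpos]
  nlinarith

open Classical in
theorem sum_blockSet_sq {w : ℝ} (hw : w ≤ 1) (h : ℕ → ℝ) (K : ℕ) :
    ∑ m ∈ Finset.range (K * K), (if m ∈ blockSet w then h m else 0) =
      ∑ k ∈ Finset.range K, ∑ i ∈ Finset.range ⌊w * (2 * (k : ℝ) + 1)⌋₊, h (k * k + i) := by
  induction K with
  | zero => simp
  | succ K ih =>
    have e : (K + 1) * (K + 1) = K * K + (2 * K + 1) := by ring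
    rw [e, Finset.sum_range_add, ih, Finset.sum_range_succ _ K]
    congr 1
    have hc : ⌊w * (2 * (K : ℝ) + 1)⌋₊ ≤ 2 * K + 1 := by
      apply Nat.floor_le_of_le
      push_cast
      nlinarith [(by positivity : (0 : ℝ) ≤ K)]
    have hmem : ∀ i ∈ Finset.range (2 * K + 1),
        (if K * K + i ∈ blockSet w then h (K * K + i) else 0)
          = if i < ⌊w * (2 * (K : ℝ) + 1)⌋₊ then h (K * K + i) else 0 := by
      intro i hi
      have hs : Nat.sqrt (K * K + i) = K :=
        Nat.sqrt_add_eq K (by have := Finset.mem_range.mp hi; omega)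
      simp [blockSet, hs]
    rw [Finset.sum_congr rfl hmem, ← Finset.sum_filter]
    congr 1
    ext i
    simp only [Finset.mem_filter, Finset.mem_range]
    omega

open Classical in
theorem HasUniformMean.tendsto_blockSet {h : ℕ → ℝ} {L w : ℝ} (hh : HasUniformMean h L)
    (hw0 : 0 ≤ w) (hw1 : w ≤ 1) :
    Tendsto (fun M : ℕ => (∑ m ∈ Finset.range M, if m ∈ blockSet w then h m else 0) / (M : ℝ))
      atTop (𝓝 (w * L)) := by
  apply tendsto_div_of_abs_sub_le_sqrt
  intro ε hε
  obtain ⟨B, hB0, hB⟩ := hh.bounded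
  obtain ⟨C, hC⟩ := hh ε hε
  have hC0 : 0 ≤ C := by simpa using hC 0 0
  refine ⟨C + |L| + 2 * B + 2 * |L|, fun M => ?_⟩
  have hsq : Nat.sqrt M * Nat.sqrt M ≤ M := Nat.sqrt_le M
  have hsq2 : M ≤ Nat.sqrt M * Nat.sqrt M + 2 * Nat.sqrt M := by
    have := Nat.sqrt_le_add M
    omega
  set K := Nat.sqrt M with hK
  obtain ⟨t, ht⟩ := Nat.exists_eq_add_of_le hsq
  have htK : (t : ℝ) ≤ 2 * K := by
    have : t ≤ 2 * K := by omega
    exact_mod_cast this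
  have hMt : (M : ℝ) = K * K + t := by exact_mod_cast ht
  set g : ℕ → ℝ := fun m => if m ∈ blockSet w then h m else 0 with hg
  have hgB : ∀ m, |g m| ≤ B := by
    intro m
    simp only [hg]
    split_ifs
    · exact hB m
    · simpa using hB0
  have hblock : ∀ k : ℕ, |∑ i ∈ Finset.range ⌊w * (2 * (k : ℝ) + 1)⌋₊, h (k * k + i)
      - w * (2 * (k : ℝ) + 1) * L| ≤ ε * (2 * k + 1) + (C + |L|) := by
    intro k
    have hpos : 0 ≤ w * (2 * (k : ℝ) + 1) := by positivity
    have h1 := hC (k * k) ⌊w * (2 * (k : ℝ) + 1)⌋₊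
    have h2 := Nat.floor_le hpos
    have h3 := Nat.lt_floor_add_one (w * (2 * (k : ℝ) + 1))
    have h4 : w * (2 * (k : ℝ) + 1) ≤ 2 * k + 1 := mul_le_of_le_one_left (by positivity) hw1
    generalize ⌊w * (2 * (k : ℝ) + 1)⌋₊ = c at *
    generalize w * (2 * (k : ℝ) + 1) = v at *
    rw [Real.norm_eq_abs, smul_eq_mul] at h1
    have h5 : |((c : ℝ) - v) * L| ≤ |L| := by
      rw [abs_mul]
      refine mul_le_of_le_one_left (abs_nonneg _) (abs_le.mpr ⟨by linarith, by linarith⟩)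
    have h6 : ε * c ≤ ε * (2 * k + 1) := by gcongr; linarith
    calc _ = |(∑ i ∈ Finset.range c, h (k * k + i) - c * L) + (c - v) * L| := by congr 1; ring
      _ ≤ _ := abs_add_le _ _
      _ ≤ _ := by linarith
  have hodd : ∀ n : ℕ, ∑ k ∈ Finset.range n, (2 * (k : ℝ) + 1) = n * n := by
    intro n
    induction n with
    | zero => simp
    | succ n ih => rw [Finset.sum_range_succ, ih]; push_cast; ring
  have hmain : |∑ m ∈ Finset.range (K * K), g m - (K * K : ℝ) * (w * L)|
      ≤ ε * (K * K) + (C + |L|) * K := by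
    have e : ∑ m ∈ Finset.range (K * K), g m - (K * K : ℝ) * (w * L)
        = ∑ k ∈ Finset.range K, (∑ i ∈ Finset.range ⌊w * (2 * (k : ℝ) + 1)⌋₊, h (k * k + i)
          - w * (2 * (k : ℝ) + 1) * L) := by
      rw [Finset.sum_sub_distrib, sum_blockSet_sq hw1, ← Finset.sum_mul, ← Finset.mul_sum, hodd]
      ring
    rw [e]
    refine (Finset.abs_sum_le_sum_abs _ _).trans ((Finset.sum_le_sum fun k _ => hblock k).trans ?_)
    rw [Finset.sum_add_distrib, ← Finset.mul_sum, hodd, Finset.sum_const, Finset.card_range,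
      nsmul_eq_mul, mul_comm (K : ℝ) (C + |L|)]
  have hrest := abs_sum_range_sub_le hgB (K * K) t
  rw [← ht] at hrest
  have hwL : |(t : ℝ) * (w * L)| ≤ |L| * t := by
    rw [abs_mul, abs_mul, abs_of_nonneg hw0, Nat.abs_cast, mul_comm]
    gcongr
    exact mul_le_of_le_one_left (abs_nonneg _) hw1
  have hfin : |∑ m ∈ Finset.range M, g m - M * (w * L)|
      ≤ (ε * (K * K) + (C + |L|) * K) + B * t + |L| * t := by
    have e : ∑ m ∈ Finset.range M, g m - M * (w * L)
        = (∑ m ∈ Finset.range (K * K), g m - (K * K : ℝ) * (w * L))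
          + (∑ m ∈ Finset.range M, g m - ∑ m ∈ Finset.range (K * K), g m)
          - t * (w * L) := by rw [hMt]; ring
    rw [e]
    refine (abs_sub _ _).trans ?_
    have := abs_add_le (∑ m ∈ Finset.range (K * K), g m - (K * K : ℝ) * (w * L))
      (∑ m ∈ Finset.range M, g m - ∑ m ∈ Finset.range (K * K), g m)
    linarith
  refine hfin.trans ?_
  have h1 : B * t ≤ B * (2 * K) := by gcongr
  have h2 : |L| * t ≤ |L| * (2 * K) := by gcongr
  have h3 : ε * (K * K) ≤ ε * M := by gcongr; rw [hMt]; linarith [(by positivity : (0 : ℝ) ≤ t)]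
  have h4 := abs_nonneg L
  nlinarith

/-- Cesàro convergence of a bounded sequence follows from convergence along multiples of `q`. -/
theorem tendsto_average_of_multiples {g : ℕ → ℝ} {B c : ℝ} {q : ℕ} (hq : 0 < q)
    (hg : ∀ n, |g n| ≤ B)
    (H : Tendsto (fun M : ℕ => (∑ n ∈ Finset.range (q * M), g n) / (M : ℝ)) atTop (𝓝 c)) :
    Tendsto (fun N : ℕ => (∑ n ∈ Finset.range N, g n) / (N : ℝ)) atTop (𝓝 (c / q)) := by
  have hB0 : 0 ≤ B := (abs_nonneg _).trans (hg 0)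
  have hq' : (0 : ℝ) < q := by exact_mod_cast hq
  have hdiv : Tendsto (fun N : ℕ => N / q) atTop atTop := Nat.tendsto_div_const_atTop hq.ne'
  have hratio : Tendsto (fun N : ℕ => ((N / q : ℕ) : ℝ) / N) atTop (𝓝 (1 / q)) := by
    have h1 := (tendsto_nat_floor_mul_div_atTop (R := ℝ) (a := 1 / q) (by positivity)).comp
      tendsto_natCast_atTop_atTop
    refine h1.congr fun N => ?_
    simp only [Function.comp]
    congr 2
    rw [one_div_mul_eq_div, Nat.floor_div_natCast, Nat.floor_natCast]
  have hmain : Tendsto (fun N : ℕ => (∑ n ∈ Finset.range (q * (N / q)), g n) / (N : ℝ)) atTop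
      (𝓝 (c / q)) := by
    have h1 := (H.comp hdiv).mul hratio
    rw [mul_one_div] at h1
    refine h1.congr' ?_
    filter_upwards [hdiv.eventually_gt_atTop 0] with N hN
    have : ((N / q : ℕ) : ℝ) ≠ 0 := by exact_mod_cast hN.ne'
    simp only [Function.comp]
    field_simp
  have hrest : Tendsto (fun N : ℕ => (∑ n ∈ Finset.range N, g n) / (N : ℝ)
      - (∑ n ∈ Finset.range (q * (N / q)), g n) / (N : ℝ)) atTop (𝓝 0) := by
    refine squeeze_zero_norm (fun N => ?_) (tendsto_const_div_atTop_nhds_zero_nat (B * q))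
    have h1 := abs_sum_range_sub_le hg (q * (N / q)) (N % q)
    rw [Nat.div_add_mod] at h1
    rw [← sub_div, Real.norm_eq_abs, abs_div, Nat.abs_cast]
    gcongr
    refine h1.trans ?_
    gcongr
    exact (Nat.mod_lt _ hq).le
  simpa using hmain.add hrest

theorem sum_range_mul (g : ℕ → ℝ) (q M : ℕ) :
    ∑ n ∈ Finset.range (q * M), g n
      = ∑ r ∈ Finset.range q, ∑ m ∈ Finset.range M, g (q * m + r) := by
  rw [Finset.sum_comm]
  induction M with
  | zero => simp
  | succ M ih => rw [mul_add, mul_one, Finset.sum_range_add, ih, Finset.sum_range_succ]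

/-- The set whose part in the residue class of `r` modulo `q` is a copy of `blockSet (w r)`. -/
def residueBlockSet (q : ℕ) (w : ℕ → ℝ) : Set ℕ := {n | n / q ∈ blockSet (w (n % q))}

section Representation

variable {q : ℕ} {w : ℕ → ℝ}

open Classical in
theorem tendsto_sum_initSeg_residueBlockSet (hq : 0 < q) (hw0 : ∀ r, 0 ≤ w r) (hw1 : ∀ r, w r ≤ 1)
    {h : ℕ → ℝ} {L : ℕ → ℝ} {B : ℝ} (hB : ∀ n, |h n| ≤ B)
    (hh : ∀ r < q, HasUniformMean (fun m => h (q * m + r)) (L r)) :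
    Tendsto (fun N : ℕ => (∑ n ∈ initSeg (residueBlockSet q w) N, h n) / (N : ℝ)) atTop
      (𝓝 ((∑ r ∈ Finset.range q, w r * L r) / q)) := by
  have hB0 : 0 ≤ B := (abs_nonneg _).trans (hB 0)
  set g : ℕ → ℝ := fun n => if n ∈ residueBlockSet q w then h n else 0 with hg
  have hgB : ∀ n, |g n| ≤ B := by
    intro n
    simp only [hg]
    split_ifs
    · exact hB n
    · simpa using hB0
  have h1 : Tendsto (fun M : ℕ => (∑ n ∈ Finset.range (q * M), g n) / (M : ℝ)) atTop
      (𝓝 (∑ r ∈ Finset.range q, w r * L r)) := by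
    have e : ∀ M : ℕ, (∑ n ∈ Finset.range (q * M), g n) / (M : ℝ)
        = ∑ r ∈ Finset.range q, (∑ m ∈ Finset.range M, g (q * m + r)) / (M : ℝ) := fun M => by
      rw [sum_range_mul, Finset.sum_div]
    simp only [e]
    refine tendsto_finsetSum _ fun r hr => ?_
    have hr' := Finset.mem_range.mp hr
    refine ((hh r hr').tendsto_blockSet (hw0 r) (hw1 r)).congr fun M => ?_
    congr 1
    refine Finset.sum_congr rfl fun m _ => ?_
    have e1 : (q * m + r) / q = m := by
      rw [Nat.mul_add_div hq, Nat.div_eq_of_lt hr', add_zero]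
    have e2 : (q * m + r) % q = r := by
      rw [Nat.mul_add_mod, Nat.mod_eq_of_lt hr']
    simp only [hg, residueBlockSet, Set.mem_ofPred_eq, e1, e2]
  have h2 := tendsto_average_of_multiples hq hgB h1
  have h3 : Tendsto (fun N : ℕ => (∑ n ∈ initSeg (residueBlockSet q w) N, h n) / (N : ℝ)
      - (∑ n ∈ Finset.range N, g n) / (N : ℝ)) atTop (𝓝 0) := by
    refine squeeze_zero_norm (fun N => ?_) (tendsto_const_div_atTop_nhds_zero_nat (2 * B))
    have e : ∑ n ∈ initSeg (residueBlockSet q w) N, h n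
        = ∑ n ∈ Finset.range N, g n + g N - g 0 := by
      rw [initSeg, Finset.sum_filter, ← Finset.sum_range_succ, Finset.range_eq_Ico,
        Finset.sum_eq_sum_Ico_succ_bot (Nat.succ_pos N), zero_add, add_sub_cancel_left]
      rfl
    rw [e, ← sub_div, Real.norm_eq_abs, abs_div, Nat.abs_cast]
    gcongr
    have := hgB N
    have := hgB 0
    have e2 : ∑ n ∈ Finset.range N, g n + g N - g 0 - ∑ n ∈ Finset.range N, g n = g N - g 0 := by
      ring
    rw [e2]
    linarith [abs_sub (g N) (g 0)]
  simpa using h2.add h3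

theorem tendsto_card_initSeg_residueBlockSet (hq : 0 < q) (hw0 : ∀ r, 0 ≤ w r)
    (hw1 : ∀ r, w r ≤ 1) (hsum : ∑ r ∈ Finset.range q, w r = 1) :
    Tendsto (fun N : ℕ => ((initSeg (residueBlockSet q w) N).card : ℝ) / (N : ℝ)) atTop
      (𝓝 (1 / q)) := by
  have := tendsto_sum_initSeg_residueBlockSet (w := w) hq hw0 hw1 (h := fun _ => 1)
    (L := fun _ => 1) (B := 1) (by simp) (fun r _ => HasUniformMean.const 1)
  simpa [hsum] using this

theorem infinite_residueBlockSet (hq : 0 < q) (hw0 : ∀ r, 0 ≤ w r)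
    (hw1 : ∀ r, w r ≤ 1) (hsum : ∑ r ∈ Finset.range q, w r = 1) :
    (residueBlockSet q w).Infinite := by
  intro hfin
  have h1 := tendsto_card_initSeg_residueBlockSet hq hw0 hw1 hsum
  have h2 : Tendsto (fun N : ℕ => ((initSeg (residueBlockSet q w) N).card : ℝ) / (N : ℝ)) atTop
      (𝓝 0) := by
    refine squeeze_zero (fun N => by positivity) (fun N => ?_)
      (tendsto_const_div_atTop_nhds_zero_nat (hfin.toFinset.card : ℝ))
    gcongr
    intro n hn
    classical
    simpa using (Finset.mem_filter.mp hn).2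
  have h3 := tendsto_nhds_unique h1 h2
  have : (0 : ℝ) < 1 / q := by positivity
  linarith

theorem tendsto_empAvg_residueBlockSet (hq : 0 < q) (hw0 : ∀ r, 0 ≤ w r)
    (hw1 : ∀ r, w r ≤ 1) (hsum : ∑ r ∈ Finset.range q, w r = 1) {α : ℝ} (f : C(UnitAddCircle, ℝ))
    {L : ℕ → ℝ} (hf : ∀ r < q, HasUniformMean
      (fun m : ℕ => f ((((q * m + r : ℕ) : ℝ) * α : ℝ) : UnitAddCircle)) (L r)) :
    Tendsto (fun N => empAvg (residueBlockSet q w) α N (fun x => f x)) atTop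
      (𝓝 (∑ r ∈ Finset.range q, w r * L r)) := by
  have h1 := tendsto_sum_initSeg_residueBlockSet (w := w) hq hw0 hw1
    (h := fun n => f (((n : ℝ) * α : ℝ) : UnitAddCircle)) (fun n => f.norm_coe_le_norm _) hf
  have h2 := tendsto_card_initSeg_residueBlockSet hq hw0 hw1 hsum
  have hq' : (q : ℝ) ≠ 0 := by exact_mod_cast hq.ne'
  have h3 := h1.div h2 (by positivity)
  have e : (∑ r ∈ Finset.range q, w r * L r) / (q : ℝ) / (1 / q)
      = ∑ r ∈ Finset.range q, w r * L r := by field_simp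
  rw [e] at h3
  refine h3.congr' ?_
  filter_upwards [eventually_gt_atTop 0] with N hN
  have hN' : (N : ℝ) ≠ 0 := by exact_mod_cast hN.ne'
  simp only [Pi.div_apply, empAvg]
  rw [div_div_div_cancel_right₀ hN', div_eq_inv_mul]

theorem isGoodSet_residueBlockSet (hq : 0 < q) (hw0 : ∀ r, 0 ≤ w r)
    (hw1 : ∀ r, w r ≤ 1) (hsum : ∑ r ∈ Finset.range q, w r = 1) :
    IsGoodSet (residueBlockSet q w) := by
  refine ⟨infinite_residueBlockSet hq hw0 hw1 hsum, fun α => ?_⟩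
  obtain ⟨μ, hμ, hμf⟩ := exists_measure_hasUniformMean (((q : ℝ) * α : ℝ) : UnitAddCircle)
  let τ : ℕ → UnitAddCircle → UnitAddCircle := fun r y => y + (((r : ℝ) * α : ℝ) : UnitAddCircle)
  have hτ : ∀ r, Continuous (τ r) := fun r => by fun_prop
  have hprob : ∀ r, IsProbabilityMeasure (μ.map (τ r)) := fun r =>
    Measure.isProbabilityMeasure_map (hτ r).measurable.aemeasurable
  refine ⟨∑ r ∈ Finset.range q, ENNReal.ofReal (w r) • μ.map (τ r), ⟨?_⟩, fun f => ?_⟩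
  · simp only [Measure.coe_finsetSum, Measure.coe_smul, Finset.sum_apply, Pi.smul_apply,
      measure_univ, smul_eq_mul, mul_one]
    rw [← ENNReal.ofReal_sum_of_nonneg fun r _ => hw0 r, hsum, ENNReal.ofReal_one]
  · have hint : ∀ r, Integrable f (μ.map (τ r)) := fun r =>
      f.continuous.integrable_of_hasCompactSupport (HasCompactSupport.of_compactSpace _)
    have e : ∫ x, f x ∂(∑ r ∈ Finset.range q, ENNReal.ofReal (w r) • μ.map (τ r))
        = ∑ r ∈ Finset.range q, w r * ∫ y, f (τ r y) ∂μ := by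
      rw [integral_finsetSum_measure fun r _ => (hint r).smul_measure ENNReal.ofReal_ne_top]
      refine Finset.sum_congr rfl fun r _ => ?_
      rw [integral_smul_measure, ENNReal.toReal_ofReal (hw0 r), smul_eq_mul,
        integral_map (hτ r).measurable.aemeasurable f.continuous.aestronglyMeasurable]
    rw [e]
    refine tendsto_empAvg_residueBlockSet hq hw0 hw1 hsum f fun r _ => ?_
    have h1 := hμf (f.comp ⟨τ r, hτ r⟩)
    refine (congrArg (HasUniformMean · _) (funext fun m => ?_)).mpr h1
    simp only [ContinuousMap.comp_apply, ContinuousMap.coe_mk, τ]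
    congr 1
    rw [← AddCircle.coe_nsmul, ← AddCircle.coe_add]
    congr 1
    rw [nsmul_eq_mul]
    push_cast
    ring

end Representation

theorem integral_eq_sum_of_compl_null {X : Type*} [MeasurableSpace X] [MeasurableSingletonClass X]
    {ν : Measure X} (s : Finset X) (hs : ν (s : Set X)ᶜ = 0) {f : X → ℝ} (hf : Integrable f ν) :
    ∫ x, f x ∂ν = ∑ x ∈ s, ν.real {x} * f x := by
  have h1 : ν.restrict s = ν := Measure.restrict_eq_self_of_ae_mem (by
    rw [ae_iff]; exact hs)
  have h2 := setIntegral_finset s (hf.integrableOn (s := (s : Set X)))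
  rwa [h1] at h2

/-- every probability measure supported on the `q`-th roots of unity
`𝕋_q = {j/q : 0 ≤ j ≤ q-1}` can be represented at `a/q` when `gcd(a,q)=1`. -/
theorem representable_at_rational (q a : ℕ) (hq : 0 < q) (ha : 0 < a)
    (hgcd : Nat.gcd a q = 1) (ν : MeasureTheory.Measure UnitAddCircle)
    [MeasureTheory.IsProbabilityMeasure ν]
    (hsupp : ν {x : UnitAddCircle | ∃ j : ℕ, j < q ∧ x = (((j : ℝ) / (q : ℝ) : ℝ) : UnitAddCircle)}ᶜ = 0) :
    ∃ S : Set ℕ, IsGoodSet S ∧ IsLimitMeasure S ((a : ℝ) / (q : ℝ)) ν := by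
  have hq' : (q : ℝ) ≠ 0 := by exact_mod_cast hq.ne'
  let p : ℕ → UnitAddCircle := fun r => (((r : ℝ) * ((a : ℝ) / q) : ℝ) : UnitAddCircle)
  have hp : ∀ r, p r = r • (((a : ℝ) / q : ℝ) : UnitAddCircle) := fun r => by
    simp only [p]
    rw [← AddCircle.coe_nsmul, nsmul_eq_mul]
  have hord : addOrderOf (((a : ℝ) / q : ℝ) : UnitAddCircle) = q := by
    have := AddCircle.addOrderOf_div_of_gcd_eq_one (p := (1 : ℝ)) hq hgcd
    rwa [mul_one] at this
  have hinj : Set.InjOn p (Finset.range q) := by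
    have := nsmul_injOn_Iio_addOrderOf (x := (((a : ℝ) / q : ℝ) : UnitAddCircle))
    rw [hord] at this
    intro r hr s hs hrs
    rw [hp, hp] at hrs
    exact this (by simpa using hr) (by simpa using hs) hrs
  have hper : ∀ m r, p (q * m + r) = p r := fun m r => by
    have h0 : q • (((a : ℝ) / q : ℝ) : UnitAddCircle) = 0 := by
      have := addOrderOf_nsmul_eq_zero (((a : ℝ) / q : ℝ) : UnitAddCircle)
      rwa [hord] at this
    rw [hp, hp, add_nsmul, mul_comm, mul_nsmul', h0, nsmul_zero, zero_add]
  let T : Finset UnitAddCircle := (Finset.range q).image p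
  have hT : ν (T : Set UnitAddCircle)ᶜ = 0 := by
    refine measure_mono_null (Set.compl_subset_compl.mpr ?_) hsupp
    rintro x ⟨j, _, rfl⟩
    obtain ⟨m, hm, hmod⟩ := Nat.exists_mul_mod_eq_of_coprime j hgcd hq.ne'
    refine Finset.mem_coe.mpr (Finset.mem_image.mpr ⟨m, Finset.mem_range.mpr hm, ?_⟩)
    have hz : ∃ z : ℤ, (a : ℤ) * m = j + q * z := by
      obtain ⟨z, hz⟩ := (Nat.modEq_iff_dvd.mp (Nat.ModEq.symm hmod) : (q : ℤ) ∣ _)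
      refine ⟨z, ?_⟩
      push_cast at hz
      linarith
    obtain ⟨z, hz⟩ := hz
    have hz' : (a : ℝ) * m = j + q * z := by exact_mod_cast hz
    have e : (m : ℝ) * ((a : ℝ) / q) = j / q + z := by
      field_simp
      linarith
    simp only [p, e, AddCircle.coe_add]
    have : ((z : ℝ) : UnitAddCircle) = 0 := by
      rw [AddCircle.coe_eq_zero_iff]
      exact ⟨z, by simp⟩
    rw [this, add_zero]
  have hintegral : ∀ f : C(UnitAddCircle, ℝ),
      ∫ x, f x ∂ν = ∑ r ∈ Finset.range q, ν.real {p r} * f (p r) := by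
    intro f
    rw [integral_eq_sum_of_compl_null T hT
      (f.continuous.integrable_of_hasCompactSupport (HasCompactSupport.of_compactSpace _))]
    exact Finset.sum_image hinj
  have hw0 : ∀ r, 0 ≤ ν.real {p r} := fun r => measureReal_nonneg
  have hw1 : ∀ r, ν.real {p r} ≤ 1 := fun r => measureReal_le_one
  have hsum : ∑ r ∈ Finset.range q, ν.real {p r} = 1 := by
    simpa using (hintegral 1).symm
  refine ⟨residueBlockSet q fun r => ν.real {p r}, isGoodSet_residueBlockSet hq hw0 hw1 hsum,
    fun f => ?_⟩
  rw [hintegral f]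
  refine tendsto_empAvg_residueBlockSet hq hw0 hw1 hsum f fun r _ => ?_
  have h1 : ∀ m : ℕ, f ((((q * m + r : ℕ) : ℝ) * ((a : ℝ) / q) : ℝ) : UnitAddCircle) = f (p r) :=
    fun m => congrArg f (hper m r)
  simp only [h1]
  exact HasUniformMean.const _
end

section
/- Let R ⊆ ℕ be an infinite set and let w be a weight supported on R that is bounded (sup_{r∈R} w(r) < ∞) and sublacunary. Then there exists an infinite set S ⊆ R such that lim_{N→∞} sup_{β∈ℝ} |(1/#S(N)) Σ_{s∈S(N)} e(sβ) − (1/w(R(N))) Σ_{r∈R(N)} w(r) e(rβ)| = 0. Consequently, if w is a good weight then S is a good set and μ_{S,β} = μ_{w,β} for every β. -/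
open MeasureTheory Filter Topology
open scoped BigOperators

/-- The compensated exponential moment of a centred Bernoulli variable is at most `1`. -/
lemma bernoulli_exp_moment_le_one {t v : ℝ} (ht : |t| ≤ 1) (hv0 : 0 ≤ v) :
    v * Real.exp (t * (1 - v) - t ^ 2 * v) + (1 - v) * Real.exp (t * (0 - v) - t ^ 2 * v) ≤ 1 := by
  have h1 : Real.exp t - 1 - t ≤ t ^ 2 :=
    (le_abs_self _).trans (Real.abs_exp_sub_one_sub_id_le ht)
  have h2 : v * Real.exp (t * (1 - v) - t ^ 2 * v) + (1 - v) * Real.exp (t * (0 - v) - t ^ 2 * v)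
      = (v * (Real.exp t - 1) + 1) * Real.exp (-(t * v) - t ^ 2 * v) := by
    have e1 : t * (1 - v) - t ^ 2 * v = t + (-(t * v) - t ^ 2 * v) := by ring
    have e2 : t * (0 - v) - t ^ 2 * v = -(t * v) - t ^ 2 * v := by ring
    rw [e1, e2, Real.exp_add]
    ring
  rw [h2]
  calc (v * (Real.exp t - 1) + 1) * Real.exp (-(t * v) - t ^ 2 * v)
      ≤ Real.exp (v * (Real.exp t - 1)) * Real.exp (-(t * v) - t ^ 2 * v) := by
        gcongr
        exact Real.add_one_le_exp _
    _ = Real.exp (v * (Real.exp t - 1 - t - t ^ 2)) := by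
        rw [← Real.exp_add]
        ring_nf
    _ ≤ 1 := by
        rw [Real.exp_le_one_iff]
        exact mul_nonpos_of_nonneg_of_nonpos hv0 (by linarith)

open Classical in
/-- Derandomised selection by conditional expectations: weights `v n ∈ [0,1]` can be rounded to
`0` or `1` while controlling countably many exponential potentials at all times. -/
lemma exists_rounding_exp_bound {ι : Type*} (a : ι → ℝ) (ha : ∀ i, 0 ≤ a i) (hs : Summable a)
    (g : ι → ℕ → ℝ) (hg : ∀ i n, |g i n| ≤ 1) (v : ℕ → ℝ) (hv0 : ∀ n, 0 ≤ v n)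
    (hv1 : ∀ n, v n ≤ 1) :
    ∃ x : ℕ → ℝ, (∀ n, x n = 0 ∨ x n = 1) ∧ (∀ n, v n = 0 → x n = 0) ∧
      ∀ n i, a i * Real.exp (∑ r ∈ Finset.range n, (g i r * (x r - v r) - g i r ^ 2 * v r))
        ≤ ∑' j, a j := by
  let F : ℕ → ℝ → ι → ℝ := fun n y i => Real.exp (g i n * (y - v n) - g i n ^ 2 * v n)
  let bit : ℕ → (ι → ℝ) → ℝ := fun n Z =>
    if v n ≠ 0 ∧ ∑' i, Z i * F n 1 i ≤ ∑' i, Z i then 1 else 0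
  let Z : ℕ → ι → ℝ := fun n => Nat.rec a (fun n z i => z i * F n (bit n z) i) n
  have hZs : ∀ n i, Z (n + 1) i = Z n i * F n (bit n (Z n)) i := fun n i => rfl
  have hZ0 : ∀ i, Z 0 i = a i := fun i => rfl
  have hbit : ∀ n z, bit n z = 0 ∨ bit n z = 1 := by
    intro n z
    simp only [bit]
    split_ifs <;> simp
  have hFb : ∀ n y i, y = 0 ∨ y = 1 → F n y i ≤ Real.exp 1 := by
    intro n y i hy
    apply Real.exp_le_exp.2
    have h1 : |g i n * (y - v n)| ≤ 1 := by
      rw [abs_mul]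
      refine mul_le_one₀ (hg i n) (abs_nonneg _) ?_
      rw [abs_le]
      rcases hy with rfl | rfl <;> constructor <;> linarith [hv0 n, hv1 n]
    have h2 : 0 ≤ g i n ^ 2 * v n := mul_nonneg (sq_nonneg _) (hv0 n)
    linarith [le_abs_self (g i n * (y - v n))]
  have hnn : ∀ n i, 0 ≤ Z n i := by
    intro n
    induction n with
    | zero => exact ha
    | succ n ih => exact fun i => mul_nonneg (ih i) (Real.exp_pos _).le
  have hstep : ∀ n y, (y = 0 ∨ y = 1) → Summable (Z n) → Summable fun i => Z n i * F n y i := by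
    intro n y hy h
    refine Summable.of_nonneg_of_le (fun i => mul_nonneg (hnn n i) (Real.exp_pos _).le)
      (fun i => mul_le_mul_of_nonneg_left (hFb n y i hy) (hnn n i)) (h.mul_right _)
  have hsum : ∀ n, Summable (Z n) := by
    intro n
    induction n with
    | zero => exact hs
    | succ n ih => exact hstep n _ (hbit n _) ih
  have hdec : ∀ n, ∑' i, Z (n + 1) i ≤ ∑' i, Z n i := by
    intro n
    have s1 := hstep n 1 (Or.inr rfl) (hsum n)
    have s0 := hstep n 0 (Or.inl rfl) (hsum n)
    have key : v n * ∑' i, Z n i * F n 1 i + (1 - v n) * ∑' i, Z n i * F n 0 i ≤ ∑' i, Z n i := by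
      rw [← tsum_mul_left, ← tsum_mul_left, ← (s1.mul_left _).tsum_add (s0.mul_left _)]
      refine ((s1.mul_left _).add (s0.mul_left _)).tsum_le_tsum (fun i => ?_) (hsum n)
      have := mul_le_mul_of_nonneg_left
        (bernoulli_exp_moment_le_one (hg i n) (hv0 n)) (hnn n i)
      simp only [F]
      linarith
    simp only [hZs]
    by_cases hc : v n ≠ 0 ∧ ∑' i, Z n i * F n 1 i ≤ ∑' i, Z n i
    · simpa only [bit, if_pos hc] using hc.2
    · simp only [bit, if_neg hc]
      by_cases h0 : v n = 0
      · simpa [h0] using key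
      · have hlt : ∑' i, Z n i < ∑' i, Z n i * F n 1 i := by
          by_contra hcon
          exact hc ⟨h0, not_lt.1 hcon⟩
        have hp : 0 < v n := lt_of_le_of_ne (hv0 n) (Ne.symm h0)
        by_contra hcon
        nlinarith [hv1 n]
  have hle : ∀ n, ∑' i, Z n i ≤ ∑' i, a i := by
    intro n
    induction n with
    | zero => exact le_rfl
    | succ n ih => exact (hdec n).trans ih
  have hform : ∀ n i, Z n i = a i * Real.exp (∑ r ∈ Finset.range n,
      (g i r * (bit r (Z r) - v r) - g i r ^ 2 * v r)) := by
    intro n i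
    induction n with
    | zero => simp [hZ0]
    | succ n ih => rw [hZs, Finset.sum_range_succ, Real.exp_add, ← mul_assoc, ← ih]
  refine ⟨fun n => bit n (Z n), fun n => hbit n _, fun n h => ?_, fun n i => ?_⟩
  · simp [bit, h]
  · rw [← hform]
    exact ((hsum n).le_tsum i fun j _ => hnn n j).trans (hle n)

lemma eC_eq_exp_I (θ : ℝ) : eC θ = Complex.exp (Complex.I * ((2 * Real.pi * θ : ℝ) : ℂ)) := by
  unfold eC
  push_cast
  ring_nf

lemma eC_re (θ : ℝ) : (eC θ).re = Real.cos (2 * Real.pi * θ) := by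
  rw [eC_eq_exp_I, mul_comm, Complex.exp_ofReal_mul_I_re]

lemma eC_im (θ : ℝ) : (eC θ).im = Real.sin (2 * Real.pi * θ) := by
  rw [eC_eq_exp_I, mul_comm, Complex.exp_ofReal_mul_I_im]

lemma norm_eC (θ : ℝ) : ‖eC θ‖ = 1 := by
  rw [eC_eq_exp_I, mul_comm, Complex.norm_exp_ofReal_mul_I]

lemma eC_add (a b : ℝ) : eC (a + b) = eC a * eC b := by
  unfold eC
  rw [← Complex.exp_add]
  push_cast
  ring_nf

lemma norm_eC_sub_eC_le (a b : ℝ) : ‖eC a - eC b‖ ≤ 2 * Real.pi * |a - b| := by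
  have h : eC a - eC b = eC b * (eC (a - b) - 1) := by
    rw [mul_sub, ← eC_add]
    simp
  rw [h, norm_mul, norm_eC, one_mul, eC_eq_exp_I]
  refine (Real.norm_exp_I_mul_ofReal_sub_one_le).trans ?_
  rw [Real.norm_eq_abs, abs_mul, abs_of_pos Real.two_pi_pos]

lemma eC_natCast_mul_fract (r : ℕ) (β : ℝ) : eC (r * Int.fract β) = eC (r * β) := by
  have h : (r : ℝ) * β = r * Int.fract β + ((r * ⌊β⌋ : ℤ) : ℝ) := by
    push_cast
    rw [← mul_add, Int.fract_add_floor]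
  have h1 : eC ((r * ⌊β⌋ : ℤ) : ℝ) = 1 := by
    unfold eC
    rw [← Complex.exp_int_mul_two_pi_mul_I (r * ⌊β⌋)]
    push_cast
    ring_nf
  rw [h, eC_add, h1, mul_one]

/-- A one-sided bound along the four quarter-turn phases of an exponential sum bounds its norm. -/
lemma norm_sum_eC_le_of_phases (s : Finset ℕ) (c : ℕ → ℝ) (θ : ℕ → ℝ) (B : ℝ)
    (h : ∀ m : ℕ, m ≤ 3 →
      ∑ r ∈ s, c r * Real.cos (2 * Real.pi * θ r + m * (Real.pi / 2)) ≤ B) :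
    ‖∑ r ∈ s, (c r : ℂ) * eC (θ r)‖ ≤ 2 * B := by
  have h0 := h 0 (by norm_num)
  have h1 := h 1 (by norm_num)
  have h2 := h 2 (by norm_num)
  have h3 := h 3 (by norm_num)
  have e2 : ∀ t : ℝ, t + (2 : ℕ) * (Real.pi / 2) = t + Real.pi := by intro t; push_cast; ring
  have e3 : ∀ t : ℝ, t + (3 : ℕ) * (Real.pi / 2) = t + Real.pi / 2 + Real.pi := by
    intro t; push_cast; ring
  simp only [e2, e3, Nat.cast_zero, Nat.cast_one, zero_mul, one_mul, add_zero, Real.cos_add_pi,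
    Real.cos_add_pi_div_two, mul_neg, neg_neg, Finset.sum_neg_distrib] at h0 h1 h2 h3
  refine (Complex.norm_le_abs_re_add_abs_im _).trans ?_
  have hre : (∑ r ∈ s, (c r : ℂ) * eC (θ r)).re = ∑ r ∈ s, c r * Real.cos (2 * Real.pi * θ r) := by
    simp [Complex.re_sum, eC_re]
  have him : (∑ r ∈ s, (c r : ℂ) * eC (θ r)).im = ∑ r ∈ s, c r * Real.sin (2 * Real.pi * θ r) := by
    simp [Complex.im_sum, eC_im]
  rw [hre, him, two_mul B]
  exact add_le_add (abs_le.2 ⟨by linarith, h0⟩) (abs_le.2 ⟨by linarith, h3⟩)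

/-- An exponential sum of length `N + 1` is determined up to `O(1)` by its values at the
frequencies `j / N ^ 2`. -/
lemma norm_sum_eC_le_of_grid (c : ℕ → ℝ) (hc : ∀ r, |c r| ≤ 1) {N : ℕ} (hN : 1 ≤ N) (B : ℝ)
    (h : ∀ j : ℕ, j ≤ N ^ 2 →
      ‖∑ r ∈ Finset.range (N + 1), (c r : ℂ) * eC (r * (j / (N ^ 2 : ℕ)))‖ ≤ B) (β : ℝ) :
    ‖∑ r ∈ Finset.range (N + 1), (c r : ℂ) * eC (r * β)‖ ≤ B + 4 * Real.pi := by
  have hN' : (1 : ℝ) ≤ N := by exact_mod_cast hN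
  set M : ℕ := N ^ 2 with hM
  have hMr : (M : ℝ) = (N : ℝ) ^ 2 := by rw [hM]; push_cast; rfl
  have hMp : (0 : ℝ) < M := by rw [hMr]; positivity
  set b := Int.fract β
  have hb0 : 0 ≤ b := Int.fract_nonneg β
  have hb1 : b < 1 := Int.fract_lt_one β
  set j := ⌊b * M⌋₊
  have hj1 : (j : ℝ) ≤ b * M := Nat.floor_le (by positivity)
  have hj2 : b * M < j + 1 := Nat.lt_floor_add_one _
  have hjM : j ≤ M := by
    have : (j : ℝ) ≤ M := hj1.trans (by nlinarith)
    exact_mod_cast this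
  have hd : |b - j / M| ≤ 1 / M := by
    have e : b - j / M = (b * M - j) / M := by field_simp
    rw [e, abs_div, abs_of_pos hMp, abs_of_nonneg (by linarith)]
    gcongr
    linarith
  have hterm : ∀ r ∈ Finset.range (N + 1),
      ‖(c r : ℂ) * eC (r * β) - (c r : ℂ) * eC (r * (j / M))‖ ≤ 2 * Real.pi / N := by
    intro r hr
    have hrN : (r : ℝ) ≤ N := by exact_mod_cast Nat.lt_succ_iff.1 (Finset.mem_range.1 hr)
    rw [← mul_sub, norm_mul, Complex.norm_real, Real.norm_eq_abs, ← eC_natCast_mul_fract]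
    calc |c r| * ‖eC (r * b) - eC (r * (j / M))‖
        ≤ 1 * (2 * Real.pi * |r * b - r * (j / M)|) := by
          gcongr
          · exact hc r
          · exact norm_eC_sub_eC_le _ _
      _ = 2 * Real.pi * (r * |b - j / M|) := by
          rw [← mul_sub, abs_mul, Nat.abs_cast, one_mul]
      _ ≤ 2 * Real.pi * (N * (1 / M)) := by gcongr
      _ = 2 * Real.pi / N := by
          rw [hMr]
          field_simp
  have hdiff : ‖∑ r ∈ Finset.range (N + 1), (c r : ℂ) * eC (r * β)
      - ∑ r ∈ Finset.range (N + 1), (c r : ℂ) * eC (r * (j / M))‖ ≤ 4 * Real.pi := by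
    rw [← Finset.sum_sub_distrib]
    refine (norm_sum_le_of_le _ hterm).trans ?_
    rw [Finset.sum_const, Finset.card_range, nsmul_eq_mul, mul_div_assoc', div_le_iff₀ (by linarith)]
    push_cast
    nlinarith [Real.pi_pos]
  have := norm_le_norm_add_norm_sub' (∑ r ∈ Finset.range (N + 1), (c r : ℂ) * eC (r * β))
    (∑ r ∈ Finset.range (N + 1), (c r : ℂ) * eC (r * (j / M)))
  linarith [h j hjM]

/-- Bounded weights with `log N = o(V N)`, `V` the partial sums, can be rounded to `0`/`1` with
an error `o(V N)` in all exponential sums, uniformly in the frequency. -/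
lemma exists_rounding_eC (v : ℕ → ℝ) (hv0 : ∀ n, 0 ≤ v n) (hv1 : ∀ n, v n ≤ 1)
    (hdiv : Tendsto (fun N => ∑ r ∈ Finset.range (N + 1), v r) atTop atTop)
    (hsub : Tendsto (fun N : ℕ => Real.log N / ∑ r ∈ Finset.range (N + 1), v r) atTop (𝓝 0)) :
    ∃ x : ℕ → ℝ, (∀ n, x n = 0 ∨ x n = 1) ∧ (∀ n, v n = 0 → x n = 0) ∧
      ∀ ε > 0, ∀ᶠ N : ℕ in atTop, ∀ β : ℝ,
        ‖∑ r ∈ Finset.range (N + 1), ((x r - v r : ℝ) : ℂ) * eC (r * β)‖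
          ≤ ε * ∑ r ∈ Finset.range (N + 1), v r := by
  let p : ℕ → ℝ := fun k => 1 / ((k : ℝ) + 1) ^ 2
  have hp : ∀ k, 0 < p k := fun k => by positivity
  have hps : Summable p := by
    have := (summable_nat_add_iff 1).2 (Real.summable_one_div_nat_pow.2 (one_lt_two))
    simpa [p] using this
  have hp0 : 0 ≤ p := fun k => (hp k).le
  let a : ℕ × ℕ × ℕ × ℕ → ℝ := fun i => p i.1 * (p i.2.1 * (p i.2.2.1 * p i.2.2.2))
  have ha : ∀ i, 0 < a i := fun i =>
    mul_pos (hp _) (mul_pos (hp _) (mul_pos (hp _) (hp _)))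
  have has : Summable a := by
    have s2 := hps.mul_of_nonneg hps hp0 hp0
    have s3 := hps.mul_of_nonneg s2 hp0 (fun i => mul_nonneg (hp0 _) (hp0 _))
    exact hps.mul_of_nonneg s3 hp0
      (fun i => mul_nonneg (hp0 _) (mul_nonneg (hp0 _) (hp0 _)))
  let u : ℕ × ℕ × ℕ × ℕ → ℕ → ℝ := fun i r =>
    Real.cos (2 * Real.pi * (r * (i.2.2.1 / i.2.1)) + i.2.2.2 * (Real.pi / 2))
  let g : ℕ × ℕ × ℕ × ℕ → ℕ → ℝ := fun i r => 1 / ((i.1 : ℝ) + 1) * u i r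
  have hu : ∀ i r, |u i r| ≤ 1 := fun i r => Real.abs_cos_le_one _
  have hg : ∀ i r, |g i r| ≤ 1 := by
    intro i r
    simp only [g]
    rw [abs_mul]
    refine mul_le_one₀ ?_ (abs_nonneg _) (hu i r)
    rw [abs_of_pos (by positivity), div_le_one (by positivity)]
    linarith [Nat.cast_nonneg (α := ℝ) i.1]
  obtain ⟨x, hx01, hx0, hx⟩ :=
    exists_rounding_exp_bound a (fun i => (ha i).le) has g hg v hv0 hv1
  refine ⟨x, hx01, hx0, fun ε hε => ?_⟩
  set T := ∑' j, a j
  have hT : 0 < T := has.tsum_pos (fun i => (ha i).le) (0, 0, 0, 0) (ha _)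
  set V : ℕ → ℝ := fun N => ∑ r ∈ Finset.range (N + 1), v r with hV
  have hmain : ∀ i N, ∑ r ∈ Finset.range (N + 1), (x r - v r) * u i r
      ≤ V N / ((i.1 : ℝ) + 1) + ((i.1 : ℝ) + 1) * Real.log (T / a i) := by
    intro i N
    have h1 := hx (N + 1) i
    rw [mul_comm, ← le_div_iff₀ (ha i), ← Real.le_log_iff_exp_le (div_pos hT (ha i))] at h1
    set L : ℝ := (i.1 : ℝ) + 1
    have hL : 0 < L := by positivity
    have h2 : 1 / L * ∑ r ∈ Finset.range (N + 1), (x r - v r) * u i r - (1 / L) ^ 2 * V N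
        ≤ Real.log (T / a i) := by
      refine le_trans ?_ h1
      rw [hV, Finset.mul_sum, Finset.mul_sum, ← Finset.sum_sub_distrib]
      refine Finset.sum_le_sum fun r _ => ?_
      have h3 : g i r ^ 2 ≤ (1 / L) ^ 2 := by
        simp only [g]
        rw [mul_pow]
        exact mul_le_of_le_one_right (by positivity) ((sq_le_one_iff_abs_le_one _).2 (hu i r))
      have h4 := mul_le_mul_of_nonneg_right h3 (hv0 r)
      have h5 : 1 / L * ((x r - v r) * u i r) = g i r * (x r - v r) := by
        simp only [g, L]
        ring
      linarith
    have h6 := mul_le_mul_of_nonneg_left h2 hL.le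
    have h7 : L * (1 / L * ∑ r ∈ Finset.range (N + 1), (x r - v r) * u i r - (1 / L) ^ 2 * V N)
        = ∑ r ∈ Finset.range (N + 1), (x r - v r) * u i r - V N / L := by
      field_simp
    linarith
  obtain ⟨k, hk⟩ := exists_nat_one_div_lt (show 0 < ε / 4 by positivity)
  set L : ℝ := (k : ℝ) + 1 with hL
  have hLp : 0 < L := by positivity
  set K : ℝ := Real.log (256 * T * L ^ 2)
  have hlim : Tendsto (fun N : ℕ => (2 * L * K + 4 * Real.pi) * (V N)⁻¹
      + 16 * L * (Real.log N / V N)) atTop (𝓝 0) := by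
    simpa using (hdiv.inv_tendsto_atTop.const_mul (2 * L * K + 4 * Real.pi)).add
      (hsub.const_mul (16 * L))
  filter_upwards [hlim.eventually (gt_mem_nhds (show 0 < ε / 2 by positivity)),
    hdiv.eventually_gt_atTop 0, eventually_ge_atTop 1] with N hN1 hVN hN β
  have hNr : (1 : ℝ) ≤ N := by exact_mod_cast hN
  have hlog : ∀ j m : ℕ, j ≤ N ^ 2 → m ≤ 3 →
      Real.log (T / a (k, N ^ 2, j, m)) ≤ K + 8 * Real.log N := by
    intro j m hj hm
    have e : K + 8 * Real.log N = Real.log (256 * T * L ^ 2 * N ^ 8) := by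
      rw [Real.log_mul (by positivity) (by positivity), Real.log_pow]
      norm_num [K]
    rw [e]
    apply Real.log_le_log (div_pos hT (ha _))
    have hj' : (j : ℝ) + 1 ≤ 2 * N ^ 2 := by
      have : (j : ℝ) ≤ N ^ 2 := by exact_mod_cast hj
      nlinarith
    have hm' : (m : ℝ) + 1 ≤ 4 := by
      have : (m : ℝ) ≤ 3 := by exact_mod_cast hm
      linarith
    have hM' : (N : ℝ) ^ 2 + 1 ≤ 2 * N ^ 2 := by nlinarith
    have e2 : T / a (k, N ^ 2, j, m)
        = T * (L ^ 2 * (((N : ℝ) ^ 2 + 1) ^ 2 * (((j : ℝ) + 1) ^ 2 * ((m : ℝ) + 1) ^ 2))) := by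
      simp only [a, p, hL]
      push_cast
      field_simp
    rw [e2]
    calc T * (L ^ 2 * (((N : ℝ) ^ 2 + 1) ^ 2 * (((j : ℝ) + 1) ^ 2 * ((m : ℝ) + 1) ^ 2)))
        ≤ T * (L ^ 2 * ((2 * N ^ 2) ^ 2 * ((2 * N ^ 2) ^ 2 * 4 ^ 2))) := by gcongr
      _ = 256 * T * L ^ 2 * N ^ 8 := by ring
  have hgrid := norm_sum_eC_le_of_grid (fun r => x r - v r) (fun r => by
      rw [abs_le]
      rcases hx01 r with h | h <;> constructor <;> linarith [hv0 r, hv1 r]) hN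
    (2 * (V N / L + L * (K + 8 * Real.log N))) (fun j hj => by
      refine norm_sum_eC_le_of_phases _ _ _ _ fun m hm => ?_
      refine (hmain (k, N ^ 2, j, m) N).trans ?_
      have := mul_le_mul_of_nonneg_left (hlog j m hj hm) hLp.le
      simp only [← hL]
      linarith) β
  refine hgrid.trans ?_
  have hVL : V N / L ≤ ε / 4 * V N := by
    rw [div_eq_mul_one_div, mul_comm]
    exact mul_le_mul_of_nonneg_right hk.le hVN.le
  have h8 := mul_le_mul_of_nonneg_right hN1.le hVN.le
  have h9 : ((2 * L * K + 4 * Real.pi) * (V N)⁻¹ + 16 * L * (Real.log N / V N)) * V N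
      = 2 * L * K + 4 * Real.pi + 16 * L * Real.log N := by
    field_simp
  have : ∑ r ∈ Finset.range (N + 1), v r = V N := rfl
  rw [this]
  nlinarith

lemma sum_initSeg_eq_sum_range {M : Type*} [AddCommMonoid M] (S : Set ℕ) (N : ℕ) (G c : ℕ → M)
    (hin : ∀ r ∈ S, r ≠ 0 → c r = G r) (hout : ∀ r, ¬ (r ∈ S ∧ r ≠ 0) → c r = 0) :
    ∑ r ∈ initSeg S N, G r = ∑ r ∈ Finset.range (N + 1), c r := by
  have hmem : ∀ r, r ∈ initSeg S N ↔ r ∈ Finset.range (N + 1) ∧ r ∈ S ∧ r ≠ 0 := by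
    intro r
    simp only [initSeg, Finset.mem_filter, Finset.mem_Icc, Finset.mem_range]
    constructor
    · rintro ⟨⟨h1, h2⟩, h3⟩
      exact ⟨by omega, h3, by omega⟩
    · rintro ⟨h1, h2, h3⟩
      exact ⟨⟨by omega, by omega⟩, h2⟩
  rw [← Finset.sum_subset (s₁ := initSeg S N) (fun r hr => ((hmem r).1 hr).1)
    (fun r hr hr' => hout r fun h => hr' ((hmem r).2 ⟨hr, h⟩))]
  exact Finset.sum_congr rfl fun r hr =>
    (hin r ((hmem r).1 hr).2.1 ((hmem r).1 hr).2.2).symm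

lemma norm_inv_mul_sub_inv_mul_le {A B : ℂ} {n V ε : ℝ} (hV : 0 < V) (hn : 0 ≤ n) (hA : ‖A‖ ≤ n)
    (hAB : ‖A - B‖ ≤ ε * V) (hnV : |n - V| ≤ ε * V) :
    ‖(n : ℂ)⁻¹ * A - (V : ℂ)⁻¹ * B‖ ≤ 2 * ε := by
  have hV' : (V : ℂ) ≠ 0 := by exact_mod_cast hV.ne'
  have hsplit : (n : ℂ)⁻¹ * A - (V : ℂ)⁻¹ * B
      = (V : ℂ)⁻¹ * (A - B) - (V : ℂ)⁻¹ * (((n - V : ℝ) : ℂ) * ((n : ℂ)⁻¹ * A)) := by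
    rcases eq_or_ne n 0 with rfl | hn0
    · have : A = 0 := norm_le_zero_iff.1 hA
      simp [this]
    · have : (n : ℂ) ≠ 0 := by exact_mod_cast hn0
      push_cast
      field_simp
      ring
  have h1 : ‖(n : ℂ)⁻¹ * A‖ ≤ 1 := by
    rw [norm_mul, norm_inv, Complex.norm_real, Real.norm_of_nonneg hn]
    exact inv_mul_le_one_of_le₀ hA hn
  have h2 : ‖((n - V : ℝ) : ℂ) * ((n : ℂ)⁻¹ * A)‖ ≤ ε * V := by
    rw [norm_mul, Complex.norm_real, Real.norm_eq_abs]
    exact (mul_le_of_le_one_right (abs_nonneg _) h1).trans hnV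
  have h3 : ∀ z : ℂ, ‖z‖ ≤ ε * V → ‖(V : ℂ)⁻¹ * z‖ ≤ ε := by
    intro z hz
    rw [norm_mul, norm_inv, Complex.norm_real, Real.norm_of_nonneg hV.le, inv_mul_le_iff₀ hV]
    linarith
  rw [hsplit]
  refine (norm_sub_le _ _).trans ?_
  linarith [h3 _ hAB, h3 _ h2]

/-- Convergence to `0` of the difference of exponential averages extends to all continuous test
functions on the circle. -/
lemma tendsto_average_sub_of_eC (S R : Set ℕ) (w : ℕ → ℝ) (hnn : ∀ r ∈ R, 0 ≤ w r)
    (h : ∀ β : ℝ, Tendsto (fun N => ((initSeg S N).card : ℂ)⁻¹ * ∑ s ∈ initSeg S N, eC ((s : ℝ) * β)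
      - ((wSum R w N : ℝ) : ℂ)⁻¹ * ∑ r ∈ initSeg R N, (w r : ℂ) * eC ((r : ℝ) * β)) atTop (𝓝 0))
    (β : ℝ) (g : C(UnitAddCircle, ℂ)) :
    Tendsto (fun N =>
      ((initSeg S N).card : ℂ)⁻¹ * ∑ s ∈ initSeg S N, g (((s : ℝ) * β : ℝ) : UnitAddCircle)
      - ((wSum R w N : ℝ) : ℂ)⁻¹ *
        ∑ r ∈ initSeg R N, (w r : ℂ) * g (((r : ℝ) * β : ℝ) : UnitAddCircle)) atTop (𝓝 0) := by
  set L : C(UnitAddCircle, ℂ) → ℕ → ℂ := fun g N =>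
    ((initSeg S N).card : ℂ)⁻¹ * ∑ s ∈ initSeg S N, g (((s : ℝ) * β : ℝ) : UnitAddCircle)
      - ((wSum R w N : ℝ) : ℂ)⁻¹ *
        ∑ r ∈ initSeg R N, (w r : ℂ) * g (((r : ℝ) * β : ℝ) : UnitAddCircle) with hL
  have hadd : ∀ g₁ g₂ N, L (g₁ + g₂) N = L g₁ N + L g₂ N := by
    intro g₁ g₂ N
    simp only [hL, ContinuousMap.add_apply, mul_add, Finset.sum_add_distrib]
    ring
  have hsmul : ∀ (c : ℂ) g N, L (c • g) N = c * L g N := by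
    intro c g N
    simp only [hL, ContinuousMap.smul_apply, smul_eq_mul, mul_left_comm _ c, ← Finset.mul_sum,
      mul_sub]
  have hbound : ∀ g N, ‖L g N‖ ≤ 2 * ‖g‖ := by
    intro g N
    have h1 : ‖((initSeg S N).card : ℂ)⁻¹ *
        ∑ s ∈ initSeg S N, g (((s : ℝ) * β : ℝ) : UnitAddCircle)‖ ≤ ‖g‖ := by
      rw [norm_mul, norm_inv, Complex.norm_natCast]
      have h2 : ‖∑ s ∈ initSeg S N, g (((s : ℝ) * β : ℝ) : UnitAddCircle)‖
          ≤ (initSeg S N).card * ‖g‖ := by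
        refine (norm_sum_le_of_le _ fun s _ => g.norm_coe_le_norm _).trans ?_
        simp
      calc _ ≤ ((initSeg S N).card : ℝ)⁻¹ * ((initSeg S N).card * ‖g‖) := by gcongr
        _ = (((initSeg S N).card : ℝ)⁻¹ * (initSeg S N).card) * ‖g‖ := by ring
        _ ≤ 1 * ‖g‖ := by
          gcongr
          exact inv_mul_le_one
        _ = ‖g‖ := one_mul _
    have hR : ∀ r ∈ initSeg R N, 0 ≤ w r := by
      intro r hr
      simp only [initSeg, Finset.mem_filter] at hr
      exact hnn r hr.2
    have h3 : ‖((wSum R w N : ℝ) : ℂ)⁻¹ *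
        ∑ r ∈ initSeg R N, (w r : ℂ) * g (((r : ℝ) * β : ℝ) : UnitAddCircle)‖ ≤ ‖g‖ := by
      have hW : 0 ≤ wSum R w N := Finset.sum_nonneg hR
      rw [norm_mul, norm_inv, Complex.norm_real, Real.norm_of_nonneg hW]
      have h2 : ‖∑ r ∈ initSeg R N, (w r : ℂ) * g (((r : ℝ) * β : ℝ) : UnitAddCircle)‖
          ≤ wSum R w N * ‖g‖ := by
        rw [wSum, Finset.sum_mul]
        refine norm_sum_le_of_le _ fun r hr => ?_
        rw [norm_mul, Complex.norm_real, Real.norm_of_nonneg (hR r hr)]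
        exact mul_le_mul_of_nonneg_left (g.norm_coe_le_norm _) (hR r hr)
      calc _ ≤ (wSum R w N)⁻¹ * (wSum R w N * ‖g‖) := by gcongr
        _ = ((wSum R w N)⁻¹ * wSum R w N) * ‖g‖ := by ring
        _ ≤ 1 * ‖g‖ := by
          gcongr
          exact inv_mul_le_one
        _ = ‖g‖ := one_mul _
    exact (norm_sub_le _ _).trans (by linarith)
  have hspan : ∀ q ∈ Submodule.span ℂ (Set.range (fourier : ℤ → C(UnitAddCircle, ℂ))),
      Tendsto (L q) atTop (𝓝 0) := by
    intro q hq
    induction hq using Submodule.span_induction with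
    | mem q hq =>
      obtain ⟨n, rfl⟩ := hq
      have hf : ∀ r : ℕ, fourier n (((r : ℝ) * β : ℝ) : UnitAddCircle) = eC (r * (n * β)) := by
        intro r
        rw [fourier_coe_apply, eC]
        push_cast
        congr 1
        ring
      have := h (n * β)
      simp only [← hf] at this
      exact this
    | zero =>
      have : L 0 = fun _ => 0 := by
        funext N
        simp [hL]
      rw [this]
      exact tendsto_const_nhds
    | add q₁ q₂ _ _ h₁ h₂ =>
      have : L (q₁ + q₂) = fun N => L q₁ N + L q₂ N := funext (hadd q₁ q₂)
      rw [this]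
      simpa using h₁.add h₂
    | smul c q _ hq =>
      have : L (c • q) = fun N => c * L q N := funext (hsmul c q)
      rw [this]
      simpa using hq.const_mul c
  have hg : g ∈ closure (Submodule.span ℂ
      (Set.range (fourier : ℤ → C(UnitAddCircle, ℂ))) : Set C(UnitAddCircle, ℂ)) := by
    have := span_fourier_closure_eq_top (T := (1 : ℝ))
    rw [← Submodule.topologicalClosure_coe, this]
    trivial
  rw [Metric.tendsto_nhds]
  intro ε hε
  obtain ⟨q, hq, hgq⟩ := Metric.mem_closure_iff.1 hg (ε / 4) (by positivity)
  filter_upwards [Metric.tendsto_nhds.1 (hspan q hq) (ε / 2) (by positivity)] with N hN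
  rw [dist_zero_right] at hN ⊢
  have h1 : L g N = L q N + L (g - q) N := by rw [← hadd, add_sub_cancel]
  rw [dist_eq_norm] at hgq
  change ‖L g N‖ < ε
  rw [h1]
  have := hbound (g - q) N
  exact (norm_add_le _ _).trans_lt (by linarith)

open Classical in
/-- A bounded sublacunary weight can be rounded to a set with uniformly close exponential
averages. -/
lemma exists_set_uniform_average_close (R : Set ℕ) (w : ℕ → ℝ)
    (hnn : ∀ r ∈ R, 0 ≤ w r) (hbdd : ∃ C : ℝ, ∀ r ∈ R, w r ≤ C)
    (hdiv : Tendsto (fun N => wSum R w N) atTop atTop)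
    (hsub : Tendsto (fun N : ℕ => Real.log N / wSum R w N) atTop (𝓝 0)) :
    ∃ S ⊆ R, S.Infinite ∧ ∀ ε > 0, ∀ᶠ N in atTop, ∀ β : ℝ,
      ‖((initSeg S N).card : ℂ)⁻¹ * ∑ s ∈ initSeg S N, eC ((s : ℝ) * β)
          - ((wSum R w N : ℝ) : ℂ)⁻¹ * ∑ r ∈ initSeg R N, (w r : ℂ) * eC ((r : ℝ) * β)‖ ≤ ε := by
  obtain ⟨C₀, hC₀⟩ := hbdd
  set C := max C₀ 1
  have hC : 0 < C := lt_of_lt_of_le one_pos (le_max_right _ _)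
  have hwC : ∀ r ∈ R, w r ≤ C := fun r hr => (hC₀ r hr).trans (le_max_left _ _)
  set v : ℕ → ℝ := fun r => if r ∈ R ∧ r ≠ 0 then C⁻¹ * w r else 0 with hv
  have hv0 : ∀ r, 0 ≤ v r := by
    intro r
    simp only [hv]
    split_ifs with h
    · exact mul_nonneg (inv_nonneg.2 hC.le) (hnn r h.1)
    · exact le_rfl
  have hv1 : ∀ r, v r ≤ 1 := by
    intro r
    simp only [hv]
    split_ifs with h
    · exact inv_mul_le_one_of_le₀ (hwC r h.1) hC.le
    · exact zero_le_one
  have hvsum : ∀ N, ∑ r ∈ Finset.range (N + 1), v r = C⁻¹ * wSum R w N := by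
    intro N
    rw [wSum, Finset.mul_sum]
    exact (sum_initSeg_eq_sum_range R N _ v (fun r hr h0 => if_pos ⟨hr, h0⟩)
      (fun r h => if_neg h)).symm
  have hvF : ∀ (F : ℕ → ℂ) N, ∑ r ∈ Finset.range (N + 1), (v r : ℂ) * F r
      = (C : ℂ)⁻¹ * ∑ r ∈ initSeg R N, (w r : ℂ) * F r := by
    intro F N
    rw [Finset.mul_sum]
    refine (sum_initSeg_eq_sum_range R N _ _ (fun r hr h0 => ?_) (fun r h => ?_)).symm
    · rw [hv]
      simp only [if_pos (And.intro hr h0)]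
      push_cast
      ring
    · rw [hv]
      simp only [if_neg h]
      simp
  obtain ⟨x, hx01, hx0, hx⟩ := exists_rounding_eC v hv0 hv1
    (by simpa only [hvsum] using hdiv.const_mul_atTop (inv_pos.2 hC))
    (by
      have := hsub.const_mul C
      rw [mul_zero] at this
      refine this.congr fun N => ?_
      rw [hvsum]
      field_simp)
  set S : Set ℕ := {r | x r = 1} with hS
  have hSv : ∀ r ∈ S, v r ≠ 0 := fun r hr h => by
    have h1 : x r = 1 := hr
    rw [hx0 r h] at h1
    exact zero_ne_one h1
  have hSR : S ⊆ R := by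
    intro r hr
    by_contra h
    exact hSv r hr (if_neg fun h' => h h'.1)
  have hxout : ∀ r, ¬ (r ∈ S ∧ r ≠ 0) → x r = 0 := by
    intro r h
    by_cases h0 : r = 0
    · exact hx0 r (if_neg fun h' => h'.2 h0)
    · exact (hx01 r).resolve_right fun h1 => h ⟨h1, h0⟩
  have hxF : ∀ (F : ℕ → ℂ) N, ∑ r ∈ Finset.range (N + 1), (x r : ℂ) * F r
      = ∑ r ∈ initSeg S N, F r := by
    intro F N
    refine (sum_initSeg_eq_sum_range S N _ _ (fun r hr h0 => ?_) (fun r h => ?_)).symm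
    · have h1 : x r = 1 := hr
      simp [h1]
    · simp [hxout r h]
  have hD : ∀ ε > 0, ∀ᶠ N in atTop, ∀ β : ℝ,
      ‖∑ s ∈ initSeg S N, eC ((s : ℝ) * β)
        - (C : ℂ)⁻¹ * ∑ r ∈ initSeg R N, (w r : ℂ) * eC ((r : ℝ) * β)‖
        ≤ ε * (C⁻¹ * wSum R w N) := by
    intro ε hε
    filter_upwards [hx ε hε] with N hN β
    have := hN β
    simpa only [Complex.ofReal_sub, sub_mul, Finset.sum_sub_distrib, hxF, hvF, hvsum] using this
  have hDcard : ∀ ε > 0, ∀ᶠ N in atTop,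
      |((initSeg S N).card : ℝ) - C⁻¹ * wSum R w N| ≤ ε * (C⁻¹ * wSum R w N) := by
    intro ε hε
    filter_upwards [hD ε hε] with N hN
    have h0 := hN 0
    have e0 : eC 0 = 1 := by simp [eC]
    simp only [mul_zero, e0, mul_one, Finset.sum_const, nsmul_eq_mul] at h0
    rw [← Complex.ofReal_sum] at h0
    rw [← Real.norm_eq_abs, ← Complex.norm_real]
    push_cast
    exact h0
  refine ⟨S, hSR, ?_, fun ε hε => ?_⟩
  · intro hfin
    have h1 : ∀ N, (initSeg S N).card ≤ hfin.toFinset.card := by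
      intro N
      refine Finset.card_le_card fun r hr => ?_
      simp only [initSeg, Finset.mem_filter] at hr
      exact hfin.mem_toFinset.2 hr.2
    obtain ⟨N, hN1, hN2⟩ := ((hDcard (1 / 2) (by norm_num)).and
      ((hdiv.const_mul_atTop (inv_pos.2 hC)).eventually_gt_atTop
        (2 * (hfin.toFinset.card : ℝ)))).exists
    have h2 : ((initSeg S N).card : ℝ) ≤ hfin.toFinset.card := by exact_mod_cast h1 N
    linarith [(abs_le.1 hN1).1]
  · filter_upwards [hD (ε / 2) (by positivity), hDcard (ε / 2) (by positivity),
      hdiv.eventually_gt_atTop 0] with N h1 h2 h3 β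
    have hA : ‖∑ s ∈ initSeg S N, eC ((s : ℝ) * β)‖ ≤ ((initSeg S N).card : ℝ) := by
      refine (norm_sum_le_of_le _ fun s _ => (norm_eC _).le).trans ?_
      simp
    have h4 := norm_inv_mul_sub_inv_mul_le (mul_pos (inv_pos.2 hC) h3) (Nat.cast_nonneg _) hA
      (h1 β) h2
    have hC' : (C : ℂ) ≠ 0 := by exact_mod_cast hC.ne'
    have e1 : ∀ z : ℂ, ((C⁻¹ * wSum R w N : ℝ) : ℂ)⁻¹ * ((C : ℂ)⁻¹ * z)
        = ((wSum R w N : ℝ) : ℂ)⁻¹ * z := by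
      intro z
      push_cast
      field_simp
    rw [e1, Complex.ofReal_natCast] at h4
    linarith

/-- for a bounded sublacunary weight `w` on `R` there is a set `S ⊆ R` whose
exponential averages are uniformly (in `β`) asymptotic to the `w`-weighted ones; hence if `w`
is a good weight then `S` is a good set with the same limit measures. -/
theorem set_from_bounded_sublacunary_weight (R : Set ℕ) (hR : R.Infinite) (w : ℕ → ℝ)
    (hnn : ∀ r ∈ R, 0 ≤ w r) (hbdd : ∃ C : ℝ, ∀ r ∈ R, w r ≤ C)
    (hdiv : Tendsto (fun N => wSum R w N) atTop atTop)
    (hsub : Tendsto (fun N : ℕ => Real.log N / wSum R w N) atTop (𝓝 0)) :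
    ∃ S ⊆ R, S.Infinite ∧
      Tendsto (fun N => ⨆ β : ℝ,
        ‖((initSeg S N).card : ℂ)⁻¹ * ∑ s ∈ initSeg S N, eC ((s : ℝ) * β)
          - ((wSum R w N : ℝ) : ℂ)⁻¹ * ∑ r ∈ initSeg R N, (w r : ℂ) * eC ((r : ℝ) * β)‖)
        atTop (𝓝 0) ∧
      ((∀ β : ℝ, ∃ μ : MeasureTheory.Measure UnitAddCircle,
          MeasureTheory.IsProbabilityMeasure μ ∧ IsWeightLimitR R w β μ) →
        IsGoodSet S ∧
        ∀ β : ℝ, ∀ μ : MeasureTheory.Measure UnitAddCircle,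
          IsWeightLimitR R w β μ → IsLimitMeasure S β μ) := by
  obtain ⟨S, hSR, hSinf, hunif⟩ := exists_set_uniform_average_close R w hnn hbdd hdiv hsub
  have hlim : ∀ β : ℝ, ∀ μ : MeasureTheory.Measure UnitAddCircle,
      IsWeightLimitR R w β μ → IsLimitMeasure S β μ := by
    intro β μ hμ f
    have hpt : ∀ β : ℝ, Tendsto (fun N =>
        ((initSeg S N).card : ℂ)⁻¹ * ∑ s ∈ initSeg S N, eC ((s : ℝ) * β)
          - ((wSum R w N : ℝ) : ℂ)⁻¹ * ∑ r ∈ initSeg R N, (w r : ℂ) * eC ((r : ℝ) * β))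
        atTop (𝓝 0) := by
      intro β
      rw [Metric.tendsto_nhds]
      intro ε hε
      filter_upwards [hunif (ε / 2) (by positivity)] with N hN
      rw [dist_zero_right]
      linarith [hN β]
    have h1 := tendsto_average_sub_of_eC S R w hnn hpt β
      ⟨fun y => (f y : ℂ), Complex.continuous_ofReal.comp f.continuous⟩
    have h2 := (Complex.continuous_re.tendsto 0).comp h1
    have h3 := h2.add (hμ f)
    rw [Complex.zero_re, zero_add] at h3
    refine h3.congr fun N => ?_
    have e : ((initSeg S N).card : ℂ)⁻¹ *
          ∑ s ∈ initSeg S N, (f (((s : ℝ) * β : ℝ) : UnitAddCircle) : ℂ)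
        - ((wSum R w N : ℝ) : ℂ)⁻¹ *
          ∑ r ∈ initSeg R N, (w r : ℂ) * (f (((r : ℝ) * β : ℝ) : UnitAddCircle) : ℂ)
        = ((empAvg S β N (fun y => f y) - (wSum R w N)⁻¹ *
          ∑ r ∈ initSeg R N, w r * f (((r : ℝ) * β : ℝ) : UnitAddCircle) : ℝ) : ℂ) := by
      simp only [empAvg]
      push_cast
      rfl
    simp only [Function.comp_apply, ContinuousMap.coe_mk]
    rw [e, Complex.ofReal_re]
    ring
  refine ⟨S, hSR, hSinf, ?_, fun hgood => ⟨⟨hSinf, fun β => ?_⟩, hlim⟩⟩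
  · rw [Metric.tendsto_nhds]
    intro ε hε
    filter_upwards [hunif (ε / 2) (by positivity)] with N hN
    rw [dist_zero_right, Real.norm_of_nonneg (Real.iSup_nonneg fun _ => norm_nonneg _)]
    exact (ciSup_le hN).trans_lt (by linarith)
  · obtain ⟨μ, hμ, hlimμ⟩ := hgood β
    exact ⟨μ, hμ, hlim β μ hlimμ⟩
end
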